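/- Let X ∈ ℝ^{2×2×1} be any tensor and let M ∈ ℝ^{2×2} be the matrix with M_{i,j} = X_{i,j,1}. Then ‖X‖' ≥ tr(M), where ‖X‖' = inf { (Σ_{r=1}^R (‖u_r^{(1)}‖₂ · ‖u_r^{(2)}‖₂ · ‖u_r^{(3)}‖₂)^{2/3})^{3/2} : R ∈ ℕ, u ∈ U_R(X) }. -/

import Mathlib

open Finset

/-- The vector ℓ_p norm on `ℝ^n`. -/
noncomputable def vecLpNorm (p : ℝ) {n : ℕ} (v : Fin n → ℝ) : ℝ :=
  (∑ i, |v i| ^ p) ^ (1 / p)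

/-- `u = (u1, u2, u3)` is a rank-`R` CP decomposition of the tensor `X`. -/
def IsCPDecomp {N₁ N₂ N₃ R : ℕ} (X : Fin N₁ × Fin N₂ × Fin N₃ → ℝ)
    (u1 : Fin R → Fin N₁ → ℝ) (u2 : Fin R → Fin N₂ → ℝ)
    (u3 : Fin R → Fin N₃ → ℝ) : Prop :=
  ∀ i j k, X (i, j, k) = ∑ r, u1 r i * u2 r j * u3 r k

/-- The (2/3)-"nuclear" quantity `‖X‖'`, infimum over all CP decompositions of `X`
of the ℓ_{2/3} quasi-norm of the spectrum. -/
noncomputable def tensorNorm23 {N₁ N₂ N₃ : ℕ} (X : Fin N₁ × Fin N₂ × Fin N₃ → ℝ) : ℝ :=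
  sInf {y : ℝ | ∃ (R : ℕ) (u1 : Fin R → Fin N₁ → ℝ) (u2 : Fin R → Fin N₂ → ℝ)
    (u3 : Fin R → Fin N₃ → ℝ), IsCPDecomp X u1 u2 u3 ∧
    y = (∑ r, (vecLpNorm 2 (u1 r) * vecLpNorm 2 (u2 r) * vecLpNorm 2 (u3 r))
      ^ ((2 : ℝ) / 3)) ^ ((3 : ℝ) / 2)}

/-- Cauchy–Schwarz for `vecLpNorm 2`. -/
lemma abs_sum_mul_le_vecLpNorm_two {n : ℕ} (v w : Fin n → ℝ) :
    |∑ i, v i * w i| ≤ vecLpNorm 2 v * vecLpNorm 2 w := by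
  refine abs_le'.mpr ⟨Real.inner_le_Lp_mul_Lq univ v w .two_two, ?_⟩
  simpa [vecLpNorm] using
    Real.inner_le_Lp_mul_Lq univ (fun i => -v i) w Real.HolderConjugate.two_two

lemma vecLpNorm_nonneg (p : ℝ) {n : ℕ} (v : Fin n → ℝ) : 0 ≤ vecLpNorm p v := by
  unfold vecLpNorm
  positivity

lemma vecLpNorm_two_fin_one (v : Fin 1 → ℝ) : vecLpNorm 2 v = |v 0| := by
  rw [vecLpNorm, Fin.sum_univ_one, ← Real.rpow_mul (abs_nonneg _)]
  norm_num

/-- The `ℓ_p` quasi-norm dominates the `ℓ_1` norm for `0 < p ≤ 1`. -/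
lemma sum_le_rpow_sum_rpow {ι : Type*} (s : Finset ι) (a : ι → ℝ) (ha : ∀ i ∈ s, 0 ≤ a i)
    {p : ℝ} (hp : 0 < p) (hp1 : p ≤ 1) :
    ∑ i ∈ s, a i ≤ (∑ i ∈ s, a i ^ p) ^ (1 / p) := by
  induction s using Finset.cons_induction with
  | empty => simp [hp.ne']
  | cons i s his ih =>
    have hs : ∀ j ∈ s, 0 ≤ a j := fun j hj => ha j (mem_cons_of_mem hj)
    have hi : 0 ≤ a i := ha i (mem_cons_self i s)
    have hsum : 0 ≤ ∑ j ∈ s, a j ^ p := sum_nonneg fun j hj => Real.rpow_nonneg (hs j hj) p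
    rw [sum_cons, sum_cons]
    calc a i + ∑ j ∈ s, a j ≤ (a i ^ p) ^ (1 / p) + (∑ j ∈ s, a j ^ p) ^ (1 / p) := by
          rw [← Real.rpow_mul hi, mul_one_div_cancel hp.ne', Real.rpow_one]
          gcongr
          exact ih hs
      _ ≤ _ := Real.add_rpow_le_rpow_add (Real.rpow_nonneg hi p) hsum
          ((one_le_div hp).mpr hp1)

/-- Expanding a matrix slice along the standard basis gives a CP decomposition. -/
lemma isCPDecomp_standard_basis {N₁ N₂ : ℕ} (X : Fin N₁ × Fin N₂ × Fin 1 → ℝ) :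
    IsCPDecomp X (fun r => Pi.single r 1) (fun r j => X (r, j, 0)) (fun _ _ => 1) := by
  intro i j k
  simp [Pi.single_apply, Subsingleton.elim k 0]

theorem stmt_10 (X : Fin 2 × Fin 2 × Fin 1 → ℝ) (M : Matrix (Fin 2) (Fin 2) ℝ)
    (hM : ∀ i j, M i j = X (i, j, 0)) :
    Matrix.trace M ≤ tensorNorm23 X := by
  refine le_csInf ⟨_, _, _, _, _, isCPDecomp_standard_basis X, rfl⟩ ?_
  rintro y ⟨R, u1, u2, u3, hu, rfl⟩
  have htrace : M.trace = ∑ r, (∑ i, u1 r i * u2 r i) * u3 r 0 := by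
    simp_rw [Matrix.trace, Matrix.diag_apply, hM, hu _ _ _, sum_mul]
    exact sum_comm
  have hterm (r : Fin R) : (∑ i, u1 r i * u2 r i) * u3 r 0 ≤
      vecLpNorm 2 (u1 r) * vecLpNorm 2 (u2 r) * vecLpNorm 2 (u3 r) := by
    rw [vecLpNorm_two_fin_one]
    refine (le_abs_self _).trans ?_
    rw [abs_mul]
    gcongr
    exact abs_sum_mul_le_vecLpNorm_two _ _
  rw [htrace]
  refine (sum_le_sum fun r _ => hterm r).trans ?_
  have hle := sum_le_rpow_sum_rpow univ
    (fun r => vecLpNorm 2 (u1 r) * vecLpNorm 2 (u2 r) * vecLpNorm 2 (u3 r))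
    (fun r _ => mul_nonneg (mul_nonneg (vecLpNorm_nonneg _ _) (vecLpNorm_nonneg _ _))
      (vecLpNorm_nonneg _ _)) (p := 2 / 3) (by norm_num) (by norm_num)
  rwa [one_div_div] at hle
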